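/- arXiv:2201.02905 — 2 statements merged into one kernel-verified Lean document; each statement's English description precedes it below -/
import Mathlib

section
/- Let k ≥ 1 and β ≥ 2 be integers, let G be a (not necessarily bipartite) graph, let U be a subgraph of G, and let H be a (β,k)-HEDCS of G \ U. Set γ := 12·√(β·ln(kβ)) + 3. Let f ≥ 0 be a real number such that every bipartite graph H' with vertex parts P' and Q', admitting a hierarchical decomposition ∅ = H'_0 ⊆ H'_1 ⊆ … ⊆ H'_k = H' with deg_{H'_i}(e) ≤ β/2 + γ for every i and every e ∈ H'_i \ H'_{i−1}, and having at least (β/2 − γ)·|P'|/2 edges, satisfies |Q'| ≥ f·|P'|. Then μ(H ∪ U) ≥ (2f/(2f+1))·μ(G). -/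
open Finset

variable {V : Type*} [DecidableEq V]

/-- Degree of a vertex in an edge set. -/
def deg (E : Finset (Sym2 V)) (v : V) : ℕ := (E.filter (fun e => v ∈ e)).card

/-- Edge-degree: the sum of the degrees of the two endpoints. -/
def edeg (E : Finset (Sym2 V)) (e : Sym2 V) : ℕ :=
  Sym2.lift ⟨fun u v => deg E u + deg E v, fun _ _ => add_comm _ _⟩ e

/-- Generalized `(β,β⁻,k)`-HEDCS of `G`: a hierarchical decomposition
`∅ = H_0 ⊆ H_1 ⊆ … ⊆ H_k = Hs` with edge-degrees in `H_i` of new edges at most `β`,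
and every edge of `G` outside `Hs` has edge-degree at least `β⁻` in `Hs`. -/
def IsHEDCSgen (G Hs : Finset (Sym2 V)) (β βm k : ℕ) : Prop :=
  Hs ⊆ G ∧ ∃ H : ℕ → Finset (Sym2 V),
    H 0 = ∅ ∧ H k = Hs ∧
    (∀ i < k, H i ⊆ H (i + 1)) ∧
    (∀ i, 1 ≤ i → i ≤ k → ∀ e ∈ H i \ H (i - 1), edeg (H i) e ≤ β) ∧
    (∀ e ∈ G \ Hs, βm ≤ edeg Hs e)

/-- `(β,k)`-HEDCS of `G`. -/
def IsHEDCS (G Hs : Finset (Sym2 V)) (β k : ℕ) : Prop :=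
  IsHEDCSgen G Hs β (β - 1) k

/-- Bipartite `(β,k)`-HEDCS with vertex parts `P` and `Q`
(the base graph is `Hs` itself, so the second HEDCS condition is vacuous). -/
def IsBipartiteHEDCS (P Q : Finset V) (Hs : Finset (Sym2 V)) (β k : ℕ) : Prop :=
  Disjoint P Q ∧
  (∀ e ∈ Hs, ∃ u v, e = s(u, v) ∧ u ∈ P ∧ v ∈ Q) ∧
  ∃ H : ℕ → Finset (Sym2 V),
    H 0 = ∅ ∧ H k = Hs ∧
    (∀ i < k, H i ⊆ H (i + 1)) ∧
    (∀ i, 1 ≤ i → i ≤ k → ∀ e ∈ H i \ H (i - 1), edeg (H i) e ≤ β)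

/-- A matching: a set of pairwise vertex-disjoint (non-loop) edges. -/
def IsMatching (M : Finset (Sym2 V)) : Prop :=
  (∀ e ∈ M, ¬ e.IsDiag) ∧
  ∀ e ∈ M, ∀ f ∈ M, e ≠ f → ∀ v : V, v ∈ e → v ∉ f

/-- The maximum matching size of the edge set `E`. -/
noncomputable def matchNum (E : Finset (Sym2 V)) : ℕ :=
  sSup {n : ℕ | ∃ M : Finset (Sym2 V), M ⊆ E ∧ IsMatching M ∧ M.card = n}


theorem card_inter_mul_card_of_disjoint_support {ι : Type*} [Fintype ι] [DecidableEq ι]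
    (S : Finset ι) (A B : Finset (ι → Bool))
    (hA : ∀ ω ω' : ι → Bool, (∀ r ∈ S, ω r = ω' r) → ω ∈ A → ω' ∈ A)
    (hB : ∀ ω ω' : ι → Bool, (∀ r ∉ S, ω r = ω' r) → ω ∈ B → ω' ∈ B) :
    (A ∩ B).card * Fintype.card (ι → Bool) = A.card * B.card := by
  let φ : (ι → Bool) × (ι → Bool) → (ι → Bool) × (ι → Bool) := fun q =>
    (fun r => if r ∈ S then q.1 r else q.2 r, fun r => if r ∈ S then q.2 r else q.1 r)
  have hφ : ∀ q, φ (φ q) = q := by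
    intro q
    ext r <;> by_cases h : r ∈ S <;> simp [φ, h]
  rw [← Finset.card_univ, ← card_product, ← card_product]
  refine card_bij' (fun q _ => φ q) (fun q _ => φ q) ?_ ?_ (fun q _ => hφ q) (fun q _ => hφ q)
  · rintro ⟨a, b⟩ h
    simp only [mem_product, mem_inter] at h ⊢
    exact ⟨hA a _ (fun r hr => by simp [φ, hr]) h.1.1, hB a _ (fun r hr => by simp [φ, hr]) h.1.2⟩
  · rintro ⟨a, b⟩ h
    simp only [mem_product, mem_inter, mem_univ, and_true] at h ⊢
    exact ⟨hA a _ (fun r hr => by simp [φ, hr]) h.1, hB b _ (fun r hr => by simp [φ, hr]) h.2⟩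

/-- The symmetric Lovász local lemma on a finite cube. -/
theorem exists_forall_notMem_of_local {ι κ : Type*} [Fintype ι] [DecidableEq ι] [DecidableEq κ]
    (E : Finset κ) (B : κ → Finset (ι → Bool)) (S : κ → Finset ι)
    (hS : ∀ j ∈ E, ∀ ω ω' : ι → Bool, (∀ r ∈ S j, ω r = ω' r) → ω ∈ B j → ω' ∈ B j)
    (D : ℕ) (hD : 0 < D) (p : ℝ)
    (hp : ∀ j ∈ E, ((B j).card : ℝ) ≤ p * Fintype.card (ι → Bool))
    (hdep : ∀ j ∈ E, (E.filter fun l => ¬ Disjoint (S j) (S l)).card ≤ D)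
    (hpD : 4 * p * D ≤ 1) : ∃ ω, ∀ j ∈ E, ω ∉ B j := by
  classical
  let avoid : Finset κ → Finset (ι → Bool) := fun T => univ.filter fun ω => ∀ j ∈ T, ω ∉ B j
  have hD' : (1 : ℝ) ≤ D := by exact_mod_cast hD
  obtain ⟨x, hx⟩ : ∃ x : ℝ, x = 1 / (2 * D) := ⟨_, rfl⟩
  have hx0 : 0 < x := by rw [hx]; positivity
  have hxD : D * x = 1 / 2 := by rw [hx]; field_simp
  have hx1 : x ≤ 1 / 2 := by nlinarith
  have hpx : 2 * p ≤ x := by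
    rw [hx, le_div_iff₀ (by positivity)]
    linarith
  have hΩ : (0 : ℝ) < Fintype.card (ι → Bool) := by exact_mod_cast Fintype.card_pos
  have key : ∀ T ⊆ E, ∀ j ∈ E,
      (1 - x) * ((avoid T).card : ℝ) ≤ ((avoid (insert j T)).card : ℝ) := by
    intro T
    induction T using Finset.strongInduction with
    | H T ih =>
    intro hT j hj
    let T₁ := T.filter fun l => Disjoint (S j) (S l)
    let T₂ := T.filter fun l => ¬ Disjoint (S j) (S l)
    have hT12 : T₁ ∪ T₂ = T := filter_union_filter_not_eq _ _
    have hT2 : T₂.card ≤ D := (card_le_card (filter_subset_filter _ hT)).trans (hdep j hj)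
    have chain : ∀ T' ⊆ T₂,
        (1 - x) ^ T'.card * ((avoid T₁).card : ℝ) ≤ ((avoid (T₁ ∪ T')).card : ℝ) := by
      intro T'
      induction T' using Finset.induction_on with
      | empty => intro _; simp
      | insert a T' ha ih' =>
        intro hsub
        have haT2 : a ∈ T₂ := hsub (mem_insert_self _ _)
        have haT : a ∈ T := (mem_filter.1 haT2).1
        have hsub' : T' ⊆ T₂ := fun b hb => hsub (mem_insert_of_mem hb)
        have hss : T₁ ∪ T' ⊂ T := by
          refine (ssubset_iff_of_subset ?_).2 ⟨a, haT, ?_⟩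
          · exact union_subset (filter_subset _ _) (hsub'.trans (filter_subset _ _))
          · rw [mem_union, not_or]
            exact ⟨fun h => (mem_filter.1 haT2).2 (mem_filter.1 h).2, ha⟩
        have h1 := ih _ hss (hss.subset.trans hT) a (hT haT)
        rw [card_insert_of_notMem ha, pow_succ', union_insert]
        calc (1 - x) * (1 - x) ^ T'.card * ((avoid T₁).card : ℝ)
            = (1 - x) * ((1 - x) ^ T'.card * ((avoid T₁).card : ℝ)) := by ring
          _ ≤ (1 - x) * ((avoid (T₁ ∪ T')).card : ℝ) :=
              mul_le_mul_of_nonneg_left (ih' hsub') (by linarith)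
          _ ≤ _ := h1
    have h2 := chain T₂ Subset.rfl
    rw [hT12] at h2
    have hbern : (1 : ℝ) / 2 ≤ (1 - x) ^ T₂.card := by
      have h := one_add_mul_le_pow (a := -x) (by linarith) T₂.card
      have hc : (T₂.card : ℝ) ≤ D := by exact_mod_cast hT2
      have : (T₂.card : ℝ) * x ≤ D * x := mul_le_mul_of_nonneg_right hc hx0.le
      rw [← sub_eq_add_neg] at h
      linarith
    have h3 : ((avoid T₁).card : ℝ) ≤ 2 * (avoid T).card := by
      have : (1 : ℝ) / 2 * (avoid T₁).card ≤ (1 - x) ^ T₂.card * (avoid T₁).card :=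
        mul_le_mul_of_nonneg_right hbern (Nat.cast_nonneg _)
      linarith
    have hind : (B j ∩ avoid T₁).card * Fintype.card (ι → Bool)
        = (B j).card * (avoid T₁).card := by
      refine card_inter_mul_card_of_disjoint_support (S j) _ _ (hS j hj) ?_
      intro ω ω' hω h
      simp only [avoid, mem_filter, mem_univ, true_and] at h ⊢
      intro l hl hmem
      have hl' := mem_filter.1 hl
      exact h l hl (hS l (hT hl'.1) ω' ω
        (fun r hr => (hω r fun hr' => disjoint_left.1 hl'.2 hr' hr).symm) hmem)
    have hle : ((B j ∩ avoid T₁).card : ℝ) ≤ p * (avoid T₁).card := by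
      have h4 : ((B j ∩ avoid T₁).card : ℝ) * Fintype.card (ι → Bool)
          = (B j).card * (avoid T₁).card := by exact_mod_cast hind
      have h5 := mul_le_mul_of_nonneg_right (hp j hj) (Nat.cast_nonneg (α := ℝ) (avoid T₁).card)
      exact le_of_mul_le_mul_right (by linarith) hΩ
    have hsplit : (avoid T).card ≤ (avoid (insert j T)).card + (B j ∩ avoid T₁).card := by
      refine (card_le_card ?_).trans (card_union_le _ _)
      intro ω hω
      simp only [avoid, mem_filter, mem_univ, true_and, mem_union, mem_inter, mem_insert] at hω ⊢
      by_cases h : ω ∈ B j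
      · exact Or.inr ⟨h, fun l hl => hω l (mem_filter.1 hl).1⟩
      · left
        rintro l (rfl | hl)
        · exact h
        · exact hω l hl
    have hsplit' : ((avoid T).card : ℝ) ≤ (avoid (insert j T)).card + (B j ∩ avoid T₁).card := by
      exact_mod_cast hsplit
    have hp0 : 0 ≤ p := by
      have := (Nat.cast_nonneg (α := ℝ) (B j).card).trans (hp j hj)
      exact nonneg_of_mul_nonneg_left this hΩ
    have h6 : p * ((avoid T₁).card : ℝ) ≤ x * (avoid T).card := by
      calc p * ((avoid T₁).card : ℝ) ≤ p * (2 * (avoid T).card) :=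
            mul_le_mul_of_nonneg_left h3 hp0
        _ = 2 * p * (avoid T).card := by ring
        _ ≤ _ := mul_le_mul_of_nonneg_right hpx (Nat.cast_nonneg _)
    linarith
  have hpos : ∀ T ⊆ E, 0 < (avoid T).card := by
    intro T
    induction T using Finset.induction_on with
    | empty => intro _; simp [avoid]
    | insert a T ha ih =>
      intro hsub
      have h1 := key T (fun b hb => hsub (mem_insert_of_mem hb)) a (hsub (mem_insert_self _ _))
      have h2 : (0 : ℝ) < (avoid T).card := by
        exact_mod_cast ih fun b hb => hsub (mem_insert_of_mem hb)
      have h3 : (0 : ℝ) < (avoid (insert a T)).card :=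
        (mul_pos (by linarith) h2).trans_le h1
      exact_mod_cast h3
  obtain ⟨ω, hω⟩ := card_pos.1 (hpos E Subset.rfl)
  exact ⟨ω, (mem_filter.1 hω).2⟩

/-- The sign `±1` of a Boolean. -/
def boolSign (b : Bool) : ℝ := if b then 1 else -1

theorem sum_exp_sum_mul_boolSign_le {ι : Type*} [Fintype ι] [DecidableEq ι] (a : ι → ℝ) (c : ℝ)
    (hc : ∑ r, a r ^ 2 ≤ c) :
    ∑ ω : ι → Bool, Real.exp (∑ r, a r * boolSign (ω r))
      ≤ Real.exp (c / 2) * Fintype.card (ι → Bool) := by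
  have h1 : ∑ ω : ι → Bool, Real.exp (∑ r, a r * boolSign (ω r))
      = ∏ r, ∑ b : Bool, Real.exp (a r * boolSign b) := by
    rw [Fintype.prod_sum]
    simp only [Real.exp_sum]
  have h2 : ∀ r, ∑ b : Bool, Real.exp (a r * boolSign b) ≤ 2 * Real.exp (a r ^ 2 / 2) := by
    intro r
    have := Real.cosh_le_exp_half_sq (a r)
    rw [Real.cosh_eq] at this
    simp [boolSign]
    linarith
  rw [h1]
  calc ∏ r, ∑ b : Bool, Real.exp (a r * boolSign b)
      ≤ ∏ r, 2 * Real.exp (a r ^ 2 / 2) :=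
        prod_le_prod (fun r _ => sum_nonneg fun b _ => (Real.exp_pos _).le) fun r _ => h2 r
    _ = Real.exp (∑ r, a r ^ 2 / 2) * Fintype.card (ι → Bool) := by
        rw [prod_mul_distrib, ← Real.exp_sum]
        simp [mul_comm]
    _ ≤ _ := by
        gcongr
        rw [← sum_div]
        linarith

/-- Hoeffding's inequality for weighted signs, in counting form. -/
theorem card_lt_abs_sum_mul_boolSign_le {ι : Type*} [Fintype ι] [DecidableEq ι] (a : ι → ℝ)
    (c s : ℝ) (hc : 0 < c) (hs : 0 ≤ s) (ha : ∑ r, a r ^ 2 ≤ c) :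
    ((univ.filter fun ω : ι → Bool => s < |∑ r, a r * boolSign (ω r)|).card : ℝ)
      ≤ 2 * Real.exp (-(s ^ 2 / (2 * c))) * Fintype.card (ι → Bool) := by
  obtain ⟨l, hl⟩ : ∃ l : ℝ, l = s / c := ⟨_, rfl⟩
  have hl0 : 0 ≤ l := by rw [hl]; positivity
  have tail : ∀ b : ι → ℝ, ∑ r, b r ^ 2 ≤ c →
      ∑ ω : ι → Bool, Real.exp (l * ∑ r, b r * boolSign (ω r))
        ≤ Real.exp (l ^ 2 * c / 2) * Fintype.card (ι → Bool) := by
    intro b hb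
    have h := sum_exp_sum_mul_boolSign_le (fun r => l * b r) (l ^ 2 * c) (by
      simp only [mul_pow, ← mul_sum]
      exact mul_le_mul_of_nonneg_left hb (sq_nonneg _))
    simpa only [mul_sum, mul_assoc] using h
  have h1 := tail a ha
  have h2 := tail (fun r => -a r) (by simpa using ha)
  have h3 : ((univ.filter fun ω : ι → Bool => s < |∑ r, a r * boolSign (ω r)|).card : ℝ)
      * Real.exp (l * s) ≤ ∑ ω : ι → Bool, (Real.exp (l * ∑ r, a r * boolSign (ω r))
        + Real.exp (l * ∑ r, -a r * boolSign (ω r))) := by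
    rw [← nsmul_eq_mul, ← sum_const]
    refine (sum_le_sum fun ω hω => ?_).trans
      (sum_le_univ_sum_of_nonneg fun ω => add_nonneg (Real.exp_pos _).le (Real.exp_pos _).le)
    have hω' := (mem_filter.1 hω).2
    have e2 : ∑ r, -a r * boolSign (ω r) = -∑ r, a r * boolSign (ω r) := by
      simp [sum_neg_distrib]
    rw [e2]
    rcases lt_abs.1 hω' with h | h
    · exact (Real.exp_le_exp.2 (mul_le_mul_of_nonneg_left h.le hl0)).trans
        (le_add_of_nonneg_right (Real.exp_pos _).le)
    · exact (Real.exp_le_exp.2 (mul_le_mul_of_nonneg_left h.le hl0)).trans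
        (le_add_of_nonneg_left (Real.exp_pos _).le)
  rw [sum_add_distrib] at h3
  have h4 : Real.exp (-(s ^ 2 / (2 * c))) * Real.exp (l * s) = Real.exp (l ^ 2 * c / 2) := by
    rw [← Real.exp_add, hl]
    congr 1
    field_simp
    ring
  refine le_of_mul_le_mul_right ?_ (Real.exp_pos (l * s))
  calc _ ≤ _ := h3
    _ ≤ 2 * Real.exp (l ^ 2 * c / 2) * Fintype.card (ι → Bool) := by linarith
    _ = _ := by rw [← h4]; ring

theorem exists_sign_discrepancy_le {V ι κ : Type*} [Fintype ι] [DecidableEq ι] [DecidableEq κ]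
    (E : Finset κ) (N : κ → Finset V) (rep : V → ι) (ε : V → ℝ) (hε : ∀ v, |ε v| ≤ 1)
    (b : ℝ) (hb : 0 < b) (hN : ∀ j ∈ E, ((N j).card : ℝ) ≤ b)
    (hfib : ∀ j ∈ E, ∀ r, ((N j).filter fun w => rep w = r).card ≤ 2)
    (D : ℕ) (hD : 0 < D)
    (hdep : ∀ j ∈ E,
      (E.filter fun l => ¬ Disjoint ((N j).image rep) ((N l).image rep)).card ≤ D)
    (s : ℝ) (hs : 0 ≤ s) (hsD : 8 * Real.exp (-(s ^ 2 / (4 * b))) * D ≤ 1) :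
    ∃ ω : ι → Bool, ∀ j ∈ E, |∑ w ∈ N j, ε w * boolSign (ω (rep w))| ≤ s := by
  have hsum : ∀ j (ω : ι → Bool), ∑ w ∈ N j, ε w * boolSign (ω (rep w))
      = ∑ r, (∑ w ∈ (N j).filter fun w => rep w = r, ε w) * boolSign (ω r) := by
    intro j ω
    rw [← sum_fiberwise (N j) rep]
    refine sum_congr rfl fun r _ => ?_
    rw [sum_mul]
    refine sum_congr rfl fun w hw => ?_
    rw [(mem_filter.1 hw).2]
  refine (exists_forall_notMem_of_local E
    (fun j => univ.filter fun ω : ι → Bool => s < |∑ w ∈ N j, ε w * boolSign (ω (rep w))|)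
    (fun j => (N j).image rep) ?_ D hD (2 * Real.exp (-(s ^ 2 / (4 * b)))) ?_ hdep
    (by linarith)).imp fun ω hω j hj => ?_
  · intro j _ ω ω' h hω
    simp only [mem_filter, mem_univ, true_and] at hω ⊢
    have e : ∑ w ∈ N j, ε w * boolSign (ω (rep w)) = ∑ w ∈ N j, ε w * boolSign (ω' (rep w)) :=
      sum_congr rfl fun w hw => by rw [h (rep w) (mem_image_of_mem _ hw)]
    rwa [← e]
  · intro j hj
    simp only [hsum]
    rw [show 4 * b = 2 * (2 * b) by ring]
    refine card_lt_abs_sum_mul_boolSign_le _ (2 * b) s (by linarith) hs ?_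
    have hcard := card_eq_sum_card_fiberwise (f := rep) (s := N j) (t := univ)
      (fun _ _ => by simp)
    have hcard' : ((N j).card : ℝ) = ∑ r, (((N j).filter fun w => rep w = r).card : ℝ) := by
      exact_mod_cast hcard
    calc ∑ r, (∑ w ∈ (N j).filter fun w => rep w = r, ε w) ^ 2
        ≤ ∑ r, 2 * (((N j).filter fun w => rep w = r).card : ℝ) := by
          refine sum_le_sum fun r _ => ?_
          have h1 : |∑ w ∈ (N j).filter fun w => rep w = r, ε w|
              ≤ (((N j).filter fun w => rep w = r).card : ℝ) :=
            (abs_sum_le_sum_abs _ _).trans ((sum_le_sum fun w _ => hε w).trans (by simp))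
          have h2 : (((N j).filter fun w => rep w = r).card : ℝ) ≤ 2 := by
            exact_mod_cast hfib j hj r
          rw [← sq_abs]
          nlinarith [abs_nonneg (∑ w ∈ (N j).filter fun w => rep w = r, ε w)]
      _ = 2 * ((N j).card : ℝ) := by rw [← mul_sum, hcard']
      _ ≤ 2 * b := by linarith [hN j hj]
  · simpa using hω j hj

theorem deg_mono {E F : Finset (Sym2 V)} (h : E ⊆ F) (v : V) : deg E v ≤ deg F v :=
  card_le_card (filter_subset_filter _ h)

theorem deg_le_edeg (E : Finset (Sym2 V)) {e : Sym2 V} {v : V} (hv : v ∈ e) :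
    deg E v ≤ edeg E e := by
  induction e using Sym2.ind with
  | _ a b =>
    rcases Sym2.mem_iff.1 hv with rfl | rfl
    · exact Nat.le_add_right _ _
    · exact Nat.le_add_left _ _

theorem deg_eq_card_filter (E : Finset (Sym2 V)) (W : Finset V) (hW : ∀ e ∈ E, ∀ w ∈ e, w ∈ W)
    (v : V) : deg E v = (W.filter fun w => s(v, w) ∈ E).card := by
  rw [deg, ← card_image_of_injective (W.filter fun w => s(v, w) ∈ E)
    (f := fun w => s(v, w)) fun a b h => Sym2.congr_right.1 h]
  congr 1
  ext e
  simp only [mem_filter, mem_image]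
  constructor
  · rintro ⟨he, w, rfl⟩
    exact ⟨w, ⟨hW _ he w (Sym2.mem_mk_right _ _), he⟩, rfl⟩
  · rintro ⟨w, ⟨_, he⟩, rfl⟩
    exact ⟨he, Sym2.mem_mk_left _ _⟩

theorem subset_of_le_of_chain {α : Type*} {H : ℕ → Finset α} {k : ℕ}
    (hmono : ∀ i < k, H i ⊆ H (i + 1)) {i : ℕ} (hi : i ≤ k) : H i ⊆ H k := by
  induction k, hi using Nat.le_induction with
  | base => exact Subset.rfl
  | succ n hn ih =>
    exact (ih fun j hj => hmono j (by omega)).trans (hmono n (by omega))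

theorem deg_le_of_chain {H : ℕ → Finset (Sym2 V)} {k β : ℕ} (h0 : H 0 = ∅)
    (hdeg : ∀ i, 1 ≤ i → i ≤ k → ∀ e ∈ H i \ H (i - 1), edeg (H i) e ≤ β)
    (v : V) {i : ℕ} (hi : i ≤ k) : deg (H i) v ≤ β := by
  induction i with
  | zero => simp [deg, h0]
  | succ i ih =>
    by_cases h : ∃ e ∈ H (i + 1) \ H i, v ∈ e
    · obtain ⟨e, he, hv⟩ := h
      exact (deg_le_edeg _ hv).trans (hdeg (i + 1) (by omega) hi e he)
    · push Not at h
      refine (card_le_card ?_).trans (ih (by omega))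
      intro e he
      rw [mem_filter] at he ⊢
      exact ⟨by_contra fun hn => h e (mem_sdiff.2 ⟨he.1, hn⟩) he.2, he.2⟩

/-- The edges of `E` whose endpoints are separated by the two-colouring `χ`. -/
def crossing (χ : V → Bool) (E : Finset (Sym2 V)) : Finset (Sym2 V) :=
  E.filter fun e => ¬ (e.map χ).IsDiag

theorem mk_mem_crossing {V : Type*} {χ : V → Bool} {E : Finset (Sym2 V)} {u v : V} :
    s(u, v) ∈ crossing χ E ↔ s(u, v) ∈ E ∧ χ u ≠ χ v := by
  simp [crossing]

theorem abs_two_mul_deg_crossing_sub_deg (χ : V → Bool) (E : Finset (Sym2 V)) (W : Finset V)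
    (hW : ∀ e ∈ E, ∀ w ∈ e, w ∈ W) (v : V) :
    |2 * (deg (crossing χ E) v : ℝ) - deg E v|
      = |∑ w ∈ W.filter fun w => s(v, w) ∈ E, boolSign (χ w)| := by
  rw [deg_eq_card_filter E W hW,
    deg_eq_card_filter (crossing χ E) W fun e he => hW e (mem_filter.1 he).1]
  have h1 : (W.filter fun w => s(v, w) ∈ crossing χ E)
      = (W.filter fun w => s(v, w) ∈ E).filter fun w => χ v ≠ χ w := by
    ext w
    simp only [mem_filter, mk_mem_crossing, and_assoc]
  have h2 : 2 * (((W.filter fun w => s(v, w) ∈ crossing χ E).card : ℕ) : ℝ)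
      - ((W.filter fun w => s(v, w) ∈ E).card : ℕ)
      = -boolSign (χ v) * ∑ w ∈ W.filter fun w => s(v, w) ∈ E, boolSign (χ w) := by
    rw [h1, card_filter, card_eq_sum_ones (W.filter fun w => s(v, w) ∈ E)]
    push_cast
    rw [mul_sum, mul_sum, ← sum_sub_distrib]
    refine sum_congr rfl fun w _ => ?_
    cases χ v <;> cases χ w <;> norm_num [boolSign]
  rw [h2, abs_mul]
  have h3 : |-boolSign (χ v)| = 1 := by cases χ v <;> norm_num [boolSign]
  rw [h3, one_mul]

/-- Every matching can be encoded by a map to `Sym2 V` whose fibres are the matching edges and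
singletons. -/
theorem IsMatching.exists_rep {M : Finset (Sym2 V)} (hM : IsMatching M) :
    ∃ rep : V → Sym2 V, (∀ v, v ∈ rep v) ∧ ∀ e ∈ M, ∀ v ∈ e, rep v = e := by
  classical
  refine ⟨fun v => if h : ∃ e ∈ M, v ∈ e then h.choose else s(v, v), fun v => ?_, ?_⟩
  · by_cases h : ∃ e ∈ M, v ∈ e
    · simpa only [dif_pos h] using h.choose_spec.2
    · simp [dif_neg h]
  · intro e he v hv
    have h : ∃ e ∈ M, v ∈ e := ⟨e, he, hv⟩
    simp only [dif_pos h]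
    by_contra hne
    exact hM.2 _ h.choose_spec.1 _ he hne v h.choose_spec.2 hv

theorem eight_mul_exp_mul_le_one {k β : ℕ} (hβ : 2 ≤ β) (hk : 1 ≤ k) :
    8 * Real.exp (-((12 * Real.sqrt ((β : ℝ) * Real.log ((k : ℝ) * β))) ^ 2 / (4 * β)))
      * ((β * (2 * (β * k)) : ℕ) : ℝ) ≤ 1 := by
  have hβ' : (2 : ℝ) ≤ β := by exact_mod_cast hβ
  have hk' : (1 : ℝ) ≤ k := by exact_mod_cast hk
  have hx : (2 : ℝ) ≤ k * β := by nlinarith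
  have hL : 0 ≤ Real.log ((k : ℝ) * β) := Real.log_nonneg (by linarith)
  have h1 : (12 * Real.sqrt ((β : ℝ) * Real.log ((k : ℝ) * β))) ^ 2 / (4 * β)
      = 36 * Real.log ((k : ℝ) * β) := by
    rw [mul_pow, Real.sq_sqrt (by positivity)]
    field_simp
    ring
  have h2 : Real.exp (-(36 * Real.log ((k : ℝ) * β))) ≤ (((k : ℝ) * β) ^ 6)⁻¹ := by
    rw [← Real.exp_log (show (0 : ℝ) < ((k : ℝ) * β) ^ 6 by positivity), ← Real.exp_neg,
      Real.log_pow]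
    apply Real.exp_le_exp.2
    push_cast
    linarith
  rw [h1]
  have h3 : ((β * (2 * (β * k)) : ℕ) : ℝ) ≤ 2 * ((k : ℝ) * β) ^ 2 := by
    push_cast
    nlinarith [mul_nonneg (mul_nonneg (sq_nonneg (β : ℝ)) (by linarith : (0 : ℝ) ≤ k))
      (by linarith : (0 : ℝ) ≤ (k : ℝ) - 1)]
  have h4 : (16 : ℝ) ≤ ((k : ℝ) * β) ^ 4 :=
    calc (16 : ℝ) = 2 ^ 4 := by norm_num
      _ ≤ _ := pow_le_pow_left₀ (by norm_num) hx 4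
  calc _ ≤ 8 * (((k : ℝ) * β) ^ 6)⁻¹ * (2 * ((k : ℝ) * β) ^ 2) := by gcongr
    _ = 16 / ((k : ℝ) * β) ^ 4 := by field_simp; norm_num
    _ ≤ 1 := (div_le_one (by positivity)).2 h4

/-- A chain of graphs of maximum degree `β` has a bipartition which separates a given matching and
halves all degrees at all levels, up to a small error. -/
theorem exists_balanced_coloring {M : Finset (Sym2 V)} (hM : IsMatching M) {k β : ℕ}
    (hβ : 2 ≤ β) (hk : 1 ≤ k) (H : ℕ → Finset (Sym2 V)) (hmono : ∀ i < k, H i ⊆ H (i + 1))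
    (hdeg : ∀ v, deg (H k) v ≤ β) :
    ∃ χ : V → Bool, (∀ e ∈ M, ¬ (e.map χ).IsDiag) ∧ ∀ i, 1 ≤ i → i ≤ k → ∀ v,
      |2 * (deg (crossing χ (H i)) v : ℝ) - deg (H i) v|
        ≤ 12 * Real.sqrt ((β : ℝ) * Real.log ((k : ℝ) * β)) := by
  classical
  obtain ⟨rep, hrep, hrepM⟩ := hM.exists_rep
  let W : Finset V := (M ∪ H k).biUnion Sym2.toFinset
  have hWM : ∀ e ∈ M, ∀ w ∈ e, w ∈ W := fun e he w hw =>
    mem_biUnion.2 ⟨e, mem_union_left _ he, Sym2.mem_toFinset.2 hw⟩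
  have hWH : ∀ i ≤ k, ∀ e ∈ H i, ∀ w ∈ e, w ∈ W := fun i hi e he w hw =>
    mem_biUnion.2 ⟨e, mem_union_right _ (subset_of_le_of_chain hmono hi he),
      Sym2.mem_toFinset.2 hw⟩
  let N : V × ℕ → Finset V := fun j => W.filter fun w => s(j.1, w) ∈ H j.2
  let I := W.image rep
  let ρ : V → Option I := fun v => if h : rep v ∈ I then some ⟨rep v, h⟩ else none
  have hρ : ∀ v ∈ W, ∀ w ∈ W, ρ v = ρ w → rep v = rep w := by
    intro v hv w hw h
    have hv' : rep v ∈ I := mem_image_of_mem _ hv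
    have hw' : rep w ∈ I := mem_image_of_mem _ hw
    simpa [ρ, dif_pos hv', dif_pos hw'] using h
  let flag : V → Bool := fun v => decide (v = (Quot.out (rep v)).1)
  have hcard : ∀ i ≤ k, ∀ v, (W.filter fun w => s(v, w) ∈ H i).card ≤ β := by
    intro i hi v
    rw [← deg_eq_card_filter (H i) W (hWH i hi)]
    exact (deg_mono (subset_of_le_of_chain hmono hi) v).trans (hdeg v)
  have htwo : ∀ e : Sym2 V, e.toFinset.card ≤ 2 := by
    intro e
    rw [Sym2.card_toFinset]
    split_ifs <;> omega
  have hfib : ∀ r, (W.filter fun w => ρ w = r).card ≤ 2 := by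
    intro r
    by_cases hne : (W.filter fun w => ρ w = r).Nonempty
    · obtain ⟨w, hw⟩ := hne
      refine (card_le_card ?_).trans (htwo (rep w))
      intro w' hw'
      rw [mem_filter] at hw hw'
      rw [Sym2.mem_toFinset, ← hρ w' hw'.1 w hw.1 (hw'.2.trans hw.2.symm)]
      exact hrep w'
    · rw [not_nonempty_iff_eq_empty.1 hne]
      simp
  refine Exists.elim (exists_sign_discrepancy_le (W ×ˢ Icc 1 k) N ρ (fun v => boolSign (flag v))
    (fun v => by cases flag v <;> simp [boolSign]) (β : ℝ) (by positivity)
    (fun j hj => by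
      have := hcard j.2 (mem_Icc.1 (mem_product.1 hj).2).2 j.1
      exact_mod_cast this)
    (fun j _ r => (card_le_card (filter_subset_filter _ (filter_subset _ _))).trans (hfib r))
    (β * (2 * (β * k))) (by positivity) ?_
    (12 * Real.sqrt ((β : ℝ) * Real.log ((k : ℝ) * β))) (by positivity)
    (eight_mul_exp_mul_le_one hβ hk)) fun ω hω => ?_
  · intro j hj
    have hjk := (mem_Icc.1 (mem_product.1 hj).2).2
    have hsub : ((W ×ˢ Icc 1 k).filter fun l => ¬ Disjoint ((N j).image ρ) ((N l).image ρ))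
        ⊆ (N j).biUnion fun w => (W.filter fun w' => ρ w' = ρ w).biUnion fun w' =>
          (W.filter fun u => s(w', u) ∈ H k) ×ˢ Icc 1 k := by
      intro l hl
      rw [mem_filter, mem_product, not_disjoint_iff] at hl
      obtain ⟨⟨hl1, hl2⟩, r, hr1, hr2⟩ := hl
      obtain ⟨w, hw, rfl⟩ := mem_image.1 hr1
      obtain ⟨w', hw', hww'⟩ := mem_image.1 hr2
      have hw'' := mem_filter.1 hw'
      refine mem_biUnion.2 ⟨w, hw, mem_biUnion.2 ⟨w', mem_filter.2 ⟨hw''.1, hww'⟩,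
        mem_product.2 ⟨mem_filter.2 ⟨hl1, ?_⟩, hl2⟩⟩⟩
      rw [Sym2.eq_swap]
      exact subset_of_le_of_chain hmono (mem_Icc.1 hl2).2 hw''.2
    refine (card_le_card hsub).trans ?_
    refine (card_biUnion_le_card_mul _ _ (2 * (β * k)) fun w _ => ?_).trans
      (Nat.mul_le_mul_right _ (hcard j.2 hjk j.1))
    refine (card_biUnion_le_card_mul _ _ (β * k) fun w' _ => ?_).trans
      (Nat.mul_le_mul_right _ (hfib _))
    rw [card_product, Nat.card_Icc, Nat.add_sub_cancel]
    exact Nat.mul_le_mul_right _ (hcard k le_rfl w')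
  · refine ⟨fun v => flag v == ω (ρ v), ?_, ?_⟩
    · intro e he
      induction e using Sym2.ind with
      | _ a b =>
        have hab : a ≠ b := fun h => hM.1 _ he (by simp [h])
        have ha := hrepM _ he a (Sym2.mem_mk_left _ _)
        have hb := hrepM _ he b (Sym2.mem_mk_right _ _)
        have hρab : ρ a = ρ b := by simp only [ρ, ha, hb]
        have hout : s((Quot.out s(a, b)).1, (Quot.out s(a, b)).2) = s(a, b) := Quot.out_eq _
        have hflag : flag a ≠ flag b := by
          simp only [flag, ha, hb]
          rcases Sym2.eq_iff.1 hout with h | h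
          · simp [h.1, hab.symm]
          · simp [h.1, hab]
        simp only [Sym2.map_mk, Sym2.mk_isDiag_iff, hρab]
        revert hflag
        cases flag a <;> cases flag b <;> cases ω (ρ b) <;> simp
    · intro i hi1 hi v
      rw [abs_two_mul_deg_crossing_sub_deg _ (H i) W (hWH i hi)]
      by_cases hv : v ∈ W
      · have h := hω (v, i) (mem_product.2 ⟨hv, mem_Icc.2 ⟨hi1, hi⟩⟩)
        refine le_of_eq_of_le ?_ h
        congr 1
        refine sum_congr rfl fun w _ => ?_
        cases flag w <;> cases ω (ρ w) <;> simp [boolSign]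
      · rw [filter_false_of_mem fun w _ hvw => hv (hWH i hi _ hvw v (Sym2.mem_mk_left _ _)),
          sum_empty, abs_zero]
        positivity

theorem IsMatching.card_le_matchNum {V : Type*} {M E : Finset (Sym2 V)} (hM : IsMatching M) (h : M ⊆ E) :
    M.card ≤ matchNum E :=
  le_csSup ⟨E.card, by rintro n ⟨M', hM', -, rfl⟩; exact card_le_card hM'⟩ ⟨M, h, hM, rfl⟩

theorem exists_isMatching_card_eq_matchNum {V : Type*} (E : Finset (Sym2 V)) :
    ∃ M ⊆ E, IsMatching M ∧ M.card = matchNum E :=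
  Nat.sSup_mem (s := {n : ℕ | ∃ M : Finset (Sym2 V), M ⊆ E ∧ IsMatching M ∧ M.card = n})
    ⟨0, ∅, empty_subset _, ⟨by simp, by simp⟩, rfl⟩
    ⟨E.card, by rintro n ⟨M', hM', -, rfl⟩; exact card_le_card hM'⟩

/-- Kőnig's theorem: a vertex cover of a bipartite graph that is no larger than a matching. -/
theorem exists_vertexCover_card_le_matchNum (E : Finset (Sym2 V)) (L R : Finset V)
    (hLR : Disjoint L R) :
    ∃ Q : Finset V, Q.card ≤ matchNum E ∧ ∀ a ∈ L, ∀ b ∈ R, s(a, b) ∈ E → a ∈ Q ∨ b ∈ Q := by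
  classical
  let N : Finset V → Finset V := fun A => R.filter fun b => ∃ a ∈ A, s(a, b) ∈ E
  obtain ⟨A, hA, hmax⟩ := exists_max_image L.powerset (fun A => (A.card : ℤ) - (N A).card)
    ⟨∅, empty_mem_powerset L⟩
  rw [mem_powerset] at hA
  refine ⟨L \ A ∪ N A, (card_union_le _ _).trans ?_, fun a ha b hb hab => ?_⟩
  swap
  · by_cases haA : a ∈ A
    · exact Or.inr (mem_union_right _ (mem_filter.2 ⟨hb, a, haA, hab⟩))
    · exact Or.inl (mem_union_left _ (mem_sdiff.2 ⟨ha, haA⟩))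
  have h0 : 0 ≤ (A.card : ℤ) - (N A).card := by
    simpa [N] using hmax ∅ (empty_mem_powerset L)
  obtain ⟨d, hd⟩ := Int.eq_ofNat_of_zero_le h0
  let t : L → Finset (V ⊕ Fin d) := fun a =>
    (R.filter fun b => s((a : V), b) ∈ E).disjSum univ
  have hall : ∀ s : Finset L, s.card ≤ (s.biUnion t).card := by
    intro s
    rcases s.eq_empty_or_nonempty with rfl | ⟨a₀, ha₀⟩
    · simp
    have h1 := hmax (s.map (Function.Embedding.subtype _)) (by
      rw [mem_powerset]
      intro x hx
      obtain ⟨y, _, rfl⟩ := mem_map.1 hx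
      exact y.2)
    have h2 : (N (s.map (Function.Embedding.subtype _))).disjSum (univ : Finset (Fin d))
        ⊆ s.biUnion t := by
      intro x hx
      rcases mem_disjSum.1 hx with ⟨b, hb, rfl⟩ | ⟨c, _, rfl⟩
      · obtain ⟨hbR, a, ha, hab⟩ := mem_filter.1 hb
        obtain ⟨a', ha', rfl⟩ := mem_map.1 ha
        exact mem_biUnion.2 ⟨a', ha', inl_mem_disjSum.2 (mem_filter.2 ⟨hbR, hab⟩)⟩
      · exact mem_biUnion.2 ⟨a₀, ha₀, inr_mem_disjSum.2 (mem_univ _)⟩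
    have h3 := card_le_card h2
    rw [card_disjSum, card_univ, Fintype.card_fin] at h3
    rw [card_map] at h1
    omega
  obtain ⟨g, hg, hgt⟩ := (all_card_le_biUnion_card_iff_exists_injective t).1 hall
  let X : Finset L := univ.filter fun a => (g a).isLeft
  have hX : ∀ a : L, ∃ b : V, a ∈ X → b ∈ R ∧ s((a : V), b) ∈ E ∧ g a = Sum.inl b := by
    intro a
    by_cases ha : a ∈ X
    swap
    · exact ⟨a, fun h => absurd h ha⟩
    obtain ⟨b, hb⟩ := Sum.isLeft_iff.1 (mem_filter.1 ha).2
    have h := hgt a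
    rw [hb, inl_mem_disjSum, mem_filter] at h
    exact ⟨b, fun _ => ⟨h.1, h.2, hb⟩⟩
  choose b hb using hX
  have hXcard : L.card ≤ X.card + d := by
    have h1 : (univ.filter fun a : L => ¬ (g a).isLeft).card ≤ d := by
      have h2 : (univ.filter fun a : L => ¬ (g a).isLeft).image g
          ⊆ (univ : Finset (Fin d)).map Function.Embedding.inr := by
        intro x hx
        obtain ⟨a, ha, rfl⟩ := mem_image.1 hx
        obtain ⟨c, hc⟩ := Sum.isRight_iff.1 (Sum.not_isLeft.1 (by simpa using ha))
        simp [hc]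
      have h3 := card_le_card h2
      rwa [card_image_of_injective _ hg, card_map, card_univ, Fintype.card_fin] at h3
    have h4 := card_filter_add_card_filter_not (s := (univ : Finset L)) fun a => (g a).isLeft
    rw [card_univ, Fintype.card_coe] at h4
    change X.card + _ = _ at h4
    omega
  have hne : ∀ a : L, a ∈ X → ∀ a' : L, a' ∈ X → (a : V) ≠ b a' := fun a _ a' ha' h =>
    disjoint_left.1 hLR a.2 (h ▸ (hb a' ha').1)
  have hinj : ∀ a : L, a ∈ X → ∀ a' : L, a' ∈ X → b a = b a' → a = a' := fun a ha a' ha' h =>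
    hg (by rw [(hb a ha).2.2, (hb a' ha').2.2, h])
  have hM : IsMatching (X.image fun a : L => s((a : V), b a)) := by
    constructor
    · intro e he
      obtain ⟨a, ha, rfl⟩ := mem_image.1 he
      exact hne a ha a ha
    · intro e he e' he' hee' v hv hv'
      obtain ⟨a, ha, rfl⟩ := mem_image.1 he
      obtain ⟨a', ha', rfl⟩ := mem_image.1 he'
      have haa' : a ≠ a' := fun h => hee' (by rw [h])
      rcases Sym2.mem_iff.1 hv with rfl | rfl <;> rcases Sym2.mem_iff.1 hv' with h | h
      · exact haa' (Subtype.ext h)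
      · exact hne a ha a' ha' h
      · exact hne a' ha' a ha h.symm
      · exact haa' (hinj a ha a' ha' h)
  have hMcard := hM.card_le_matchNum (E := E) (by
    intro e he
    obtain ⟨a, ha, rfl⟩ := mem_image.1 he
    exact (hb a ha).2.1)
  rw [card_image_of_injOn] at hMcard
  · have h5 := card_sdiff_add_card_eq_card hA
    omega
  · intro a ha a' ha' h
    rcases Sym2.eq_iff.1 h with h | h
    · exact Subtype.ext h.1
    · exact absurd h.1 (hne a ha a' ha')

theorem IsMatching.sum_biUnion_toFinset {M : Finset (Sym2 V)} (hM : IsMatching M) (g : V → ℝ) :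
    ∑ v ∈ M.biUnion Sym2.toFinset, g v = ∑ e ∈ M, ∑ v ∈ e.toFinset, g v := by
  refine sum_biUnion fun e he e' he' hne => ?_
  simp only [Function.onFun, disjoint_left, Sym2.mem_toFinset]
  exact fun v => hM.2 e he e' he' hne v

/-- Let `G` be a general graph, `U ⊆ G`, `H` a `(β,k)`-HEDCS of `G \ U`,
and `γ = 12·√(β·ln(kβ)) + 3`. If `f ≥ 0` is such that every bipartite graph with parts
`P'`, `Q'` admitting a `k`-level hierarchical decomposition with edge-degree bound
`β/2 + γ` and having at least `(β/2 − γ)·|P'|/2` edges satisfies `|Q'| ≥ f·|P'|`, then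
`μ(H ∪ U) ≥ (2f/(2f+1))·μ(G)`. -/
theorem hedcs_approx_general {V : Type*} [DecidableEq V]
    (β k : ℕ) (hβ : 2 ≤ β) (hk : 1 ≤ k)
    (G U Hs : Finset (Sym2 V))
    (hG : ∀ e ∈ G, ¬ e.IsDiag) (hU : U ⊆ G)
    (hH : IsHEDCS (G \ U) Hs β k)
    (γ : ℝ) (hγ : γ = 12 * Real.sqrt ((β : ℝ) * Real.log ((k : ℝ) * β)) + 3)
    (f : ℝ) (hf : 0 ≤ f)
    (hfprop : ∀ (P' Q' : Finset V) (H' : ℕ → Finset (Sym2 V)),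
      Disjoint P' Q' →
      H' 0 = ∅ →
      (∀ i < k, H' i ⊆ H' (i + 1)) →
      (∀ e ∈ H' k, ∃ u v, e = s(u, v) ∧ u ∈ P' ∧ v ∈ Q') →
      (∀ i, 1 ≤ i → i ≤ k → ∀ e ∈ H' i \ H' (i - 1),
        (edeg (H' i) e : ℝ) ≤ (β : ℝ) / 2 + γ) →
      ((β : ℝ) / 2 - γ) * P'.card / 2 ≤ ((H' k).card : ℝ) →
      f * P'.card ≤ (Q'.card : ℝ)) :
    2 * f / (2 * f + 1) * (matchNum G : ℝ) ≤ (matchNum (Hs ∪ U) : ℝ) := by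
  classical
  obtain ⟨-, H, h0, rfl, hmono, hdeg, hout⟩ := hH
  obtain ⟨M, hMG, hM, hMcard⟩ := exists_isMatching_card_eq_matchNum G
  obtain ⟨χ, hχM, hχ⟩ := exists_balanced_coloring hM hβ hk H hmono
    fun v => deg_le_of_chain h0 hdeg v le_rfl
  have hbal : ∀ i, 1 ≤ i → i ≤ k → ∀ v,
      |2 * (deg (crossing χ (H i)) v : ℝ) - deg (H i) v| ≤ γ - 3 := by
    intro i hi1 hik v
    rw [hγ, add_sub_cancel_right]
    exact hχ i hi1 hik v
  let W := (G ∪ H k).biUnion Sym2.toFinset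
  have hWG : ∀ e ∈ G, ∀ v ∈ e, v ∈ W := fun e he v hv =>
    mem_biUnion.2 ⟨e, mem_union_left _ he, Sym2.mem_toFinset.2 hv⟩
  have hWH : ∀ e ∈ H k, ∀ v ∈ e, v ∈ W := fun e he v hv =>
    mem_biUnion.2 ⟨e, mem_union_right _ he, Sym2.mem_toFinset.2 hv⟩
  obtain ⟨Q, hQcard, hQ⟩ := exists_vertexCover_card_le_matchNum (H k ∪ U)
    (W.filter fun v => χ v = true) (W.filter fun v => χ v = false)
    (disjoint_filter.2 fun v _ h => by simp [h])
  have hcover : ∀ a ∈ W, ∀ b ∈ W, s(a, b) ∈ H k ∪ U → χ a ≠ χ b → a ∉ Q → b ∈ Q := by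
    intro a ha b hb hab hne haQ
    cases hχa : χ a with
    | true =>
      have hχb : χ b = false := by simpa [hχa] using hne.symm
      exact (hQ a (mem_filter.2 ⟨ha, hχa⟩) b (mem_filter.2 ⟨hb, hχb⟩) hab).resolve_left haQ
    | false =>
      have hχb : χ b = true := by simpa [hχa] using hne.symm
      rw [Sym2.eq_swap] at hab
      exact (hQ b (mem_filter.2 ⟨hb, hχb⟩) a (mem_filter.2 ⟨ha, hχa⟩) hab).resolve_right haQ
  let M₁ := M.filter fun e => ∀ v ∈ e, v ∉ Q
  have hM₁ : IsMatching M₁ :=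
    ⟨fun e he => hM.1 e (mem_filter.1 he).1, fun e he e' he' =>
      hM.2 e (mem_filter.1 he).1 e' (mem_filter.1 he').1⟩
  have hsplit : M.card ≤ M₁.card + Q.card := by
    rw [← card_filter_add_card_filter_not (s := M) fun e => ∀ v ∈ e, v ∉ Q]
    refine Nat.add_le_add_left ?_ _
    refine card_le_card_of_forall_subsingleton (fun e v => v ∈ e) (fun e he => ?_) ?_
    · have h := (mem_filter.1 he).2
      push Not at h
      obtain ⟨v, hv, hvQ⟩ := h
      exact ⟨v, hvQ, hv⟩
    · rintro v _ e ⟨he, hv⟩ e' ⟨he', hv'⟩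
      by_contra hne
      exact hM.2 e (mem_filter.1 he).1 e' (mem_filter.1 he').1 hne v hv hv'
  let P := M₁.biUnion Sym2.toFinset
  have hP : ∀ v ∈ P, v ∈ W ∧ v ∉ Q := by
    intro v hv
    obtain ⟨e, he, hve⟩ := mem_biUnion.1 hv
    rw [Sym2.mem_toFinset] at hve
    have he' := mem_filter.1 he
    exact ⟨hWG e (hMG he'.1) v hve, he'.2 v hve⟩
  have hPcard : (P.card : ℝ) = 2 * M₁.card := by
    have h := hM₁.sum_biUnion_toFinset fun _ => 1
    rw [sum_const, nsmul_one] at h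
    rw [h, sum_congr rfl fun e he => by
      rw [sum_const, Sym2.card_toFinset_of_not_isDiag e (hM₁.1 e he)], sum_const]
    simp [mul_comm]
  have hPQ : ∀ p ∈ P, ∀ w, s(p, w) ∈ crossing χ (H k) → w ∈ Q := by
    intro p hp w hpw
    rw [mk_mem_crossing] at hpw
    exact hcover p (hP p hp).1 w (hWH _ hpw.1 w (Sym2.mem_mk_right _ _))
      (mem_union_left _ hpw.1) hpw.2 (hP p hp).2
  let H' : ℕ → Finset (Sym2 V) := fun i => (crossing χ (H i)).filter fun e => ∃ p ∈ P, p ∈ e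
  have hcount : ((β : ℝ) / 2 - γ) * P.card / 2 ≤ ((H' k).card : ℝ) := by
    have h1 : ∑ v ∈ P, deg (crossing χ (H k)) v ≤ (H' k).card := by
      unfold deg
      rw [← card_biUnion]
      · refine card_le_card fun e he => ?_
        obtain ⟨v, hv, hve⟩ := mem_biUnion.1 he
        have hve' := mem_filter.1 hve
        exact mem_filter.2 ⟨hve'.1, v, hv, hve'.2⟩
      · intro v hv v' hv' hne
        refine disjoint_left.2 fun e he he' => ?_
        rw [mem_filter] at he he'
        obtain ⟨w, rfl⟩ := Sym2.mem_iff_exists.1 he.2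
        rcases Sym2.mem_iff.1 he'.2 with h | h
        · exact hne h.symm
        · exact (hP v' hv').2 (h ▸ hPQ v hv w he.1)
    have h2 : ∀ e ∈ M₁, (β : ℝ) / 2 - γ
        ≤ ∑ v ∈ e.toFinset, (deg (crossing χ (H k)) v : ℝ) := by
      intro e he
      induction e using Sym2.ind with
      | _ a b =>
        have he' := mem_filter.1 he
        have hab : a ≠ b := fun h => hM₁.1 _ he (by simp [h])
        have hχab : χ a ≠ χ b := by simpa using hχM _ he'.1
        have hnot : s(a, b) ∉ H k ∪ U := fun h =>
          he'.2 b (Sym2.mem_mk_right _ _)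
            (hcover a (hWG _ (hMG he'.1) a (Sym2.mem_mk_left _ _)) b
              (hWG _ (hMG he'.1) b (Sym2.mem_mk_right _ _)) h hχab
              (he'.2 a (Sym2.mem_mk_left _ _)))
        rw [mem_union, not_or] at hnot
        have h3 : β - 1 ≤ deg (H k) a + deg (H k) b :=
          hout _ (mem_sdiff.2 ⟨mem_sdiff.2 ⟨hMG he'.1, hnot.2⟩, hnot.1⟩)
        have h4 : (β : ℝ) ≤ deg (H k) a + deg (H k) b + 1 := by
          exact_mod_cast Nat.sub_le_iff_le_add.1 h3
        have h5 := (abs_le.1 (hbal k hk le_rfl a)).1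
        have h6 := (abs_le.1 (hbal k hk le_rfl b)).1
        have h7 : (s(a, b)).toFinset = {a, b} := by
          ext v
          simp
        rw [h7, sum_pair hab]
        linarith
    have h3 := sum_le_sum h2
    rw [← hM₁.sum_biUnion_toFinset, sum_const, nsmul_eq_mul] at h3
    have h4 : (∑ v ∈ P, (deg (crossing χ (H k)) v : ℝ)) ≤ ((H' k).card : ℝ) := by
      exact_mod_cast h1
    rw [hPcard]
    calc ((β : ℝ) / 2 - γ) * (2 * M₁.card) / 2 = M₁.card * ((β : ℝ) / 2 - γ) := by ring
      _ ≤ _ := h3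
      _ ≤ _ := h4
  have hfPQ := hfprop P Q H' (disjoint_left.2 fun v hv => (hP v hv).2)
    (by simp [H', crossing, h0])
    (fun i hi => filter_subset_filter _ (filter_subset_filter _ (hmono i hi)))
    (fun e he => by
      obtain ⟨hec, p, hp, hpe⟩ := mem_filter.1 he
      obtain ⟨w, rfl⟩ := Sym2.mem_iff_exists.1 hpe
      exact ⟨p, w, rfl, hp, hPQ p hp w hec⟩)
    (fun i hi1 hik e he => by
      rw [mem_sdiff] at he
      obtain ⟨hec, hep⟩ := mem_filter.1 he.1
      obtain ⟨heH, heχ⟩ := mem_filter.1 hec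
      have hold : e ∉ H (i - 1) := fun h =>
        he.2 (mem_filter.2 ⟨mem_filter.2 ⟨h, heχ⟩, hep⟩)
      have h1 := hdeg i hi1 hik e (mem_sdiff.2 ⟨heH, hold⟩)
      induction e using Sym2.ind with
      | _ a b =>
        have h2 : ((deg (H i) a : ℝ) + deg (H i) b) ≤ β := by exact_mod_cast h1
        have h3 : ∀ v, (deg (H' i) v : ℝ) ≤ deg (crossing χ (H i)) v := fun v => by
          exact_mod_cast deg_mono (filter_subset _ _) v
        have h4 := (abs_le.1 (hbal i hi1 hik a)).2
        have h5 := (abs_le.1 (hbal i hi1 hik b)).2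
        change ((deg (H' i) a + deg (H' i) b : ℕ) : ℝ) ≤ _
        push_cast
        linarith [h3 a, h3 b])
    hcount
  have hQ' : (Q.card : ℝ) ≤ matchNum (H k ∪ U) := by exact_mod_cast hQcard
  have hM' : (matchNum G : ℝ) ≤ M₁.card + Q.card := by
    rw [← hMcard]
    exact_mod_cast hsplit
  rw [hPcard] at hfPQ
  rw [div_mul_eq_mul_div, div_le_iff₀ (by linarith)]
  nlinarith [mul_le_mul_of_nonneg_left hM' hf, mul_le_mul_of_nonneg_left hQ' hf]
end

section
/- Every bipartite (35,3)-HEDCS H with vertex parts P and Q having at least 34·|P|/2 = 17·|P| edges satisfies |Q| ≥ 0.645·|P|. -/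
open Finset

variable {V : Type*} [DecidableEq V]

/-- The charge received by an edge of the first level from its endpoint in `Q`, as a function of the
degree of that endpoint within the level. -/
def bottomWeight (t : ℕ) : ℕ :=
  [951, 951, 951, 942, 941, 941, 941, 921, 915, 915, 901, 900,
    884, 875, 865, 853, 842, 827, 813, 800, 785, 771, 755, 739,
    723, 710, 682, 678, 664, 638, 638, 596, 588, 588, 588].getD t 0

/-- The charge received by an edge of the second level from its endpoint in `Q`, as a function of the
degree of that endpoint within the level. -/
def middleWeight (t : ℕ) : ℕ :=
  [1090, 1090, 1090, 1090, 1090, 1090, 1066, 1066, 1053, 1053, 1028, 1021,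
    999, 978, 958, 936, 908, 885, 863, 818, 769, 738, 738, 700,
    667, 628, 586, 545, 509, 474, 421, 374, 308, 281, 0].getD t 0

/-- The charge received by an edge of the third level from its endpoint in `Q`, as a function of the
degree of that endpoint within the level. -/
def topWeight (t : ℕ) : ℕ :=
  [1142, 1142, 1142, 1142, 1142, 1142, 1142, 1142, 1142, 1142, 1142, 1142,
    1142, 1142, 1142, 1117, 1111, 1111, 1111, 1039, 895, 876, 797, 728,
    658, 570, 475, 395, 248, 217, 0, 0, 0, 0, 0].getD t 0

lemma antitone_of_succ_le_of_eq_zero {w : ℕ → ℕ} {n : ℕ} (hw : ∀ t < n, w (t + 1) ≤ w t)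
    (h0 : ∀ t, n < t → w t = 0) : Antitone w := by
  refine antitone_nat_of_succ_le fun t => ?_
  rcases lt_or_ge t n with h | h
  · exact hw t h
  · rw [h0 (t + 1) (by omega)]
    exact Nat.zero_le _

lemma bottomWeight_antitone : Antitone bottomWeight := by
  refine antitone_of_succ_le_of_eq_zero (n := 35) (by decide +kernel) fun t ht => ?_
  exact List.getD_eq_default _ _ (by simp only [List.length_cons, List.length_nil]; omega)

lemma middleWeight_antitone : Antitone middleWeight := by
  refine antitone_of_succ_le_of_eq_zero (n := 35) (by decide +kernel) fun t ht => ?_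
  exact List.getD_eq_default _ _ (by simp only [List.length_cons, List.length_nil]; omega)

lemma topWeight_antitone : Antitone topWeight := by
  refine antitone_of_succ_le_of_eq_zero (n := 35) (by decide +kernel) fun t ht => ?_
  exact List.getD_eq_default _ _ (by simp only [List.length_cons, List.length_nil]; omega)

/-- A vertex of `Q` distributes a total charge of at most `20000`. -/
lemma charge_le {x y z : ℕ} (h : x + y + z < 35) :
    x * bottomWeight x + y * middleWeight (x + y) + z * topWeight (x + y + z) ≤ 20000 := by
  have key : ∀ x < 35, ∀ y < 35 - x, ∀ z < 35 - x - y,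
      x * bottomWeight x + y * middleWeight (x + y) + z * topWeight (x + y + z) ≤ 20000 := by
    decide +kernel
  exact key x (by omega) y (by omega) z (by omega)

/-- A vertex of `P` of degree `d` collects a total charge of at least `12900 + 1142 * (d - 17)`. -/
lemma le_charge {x y z : ℕ} (h : x + y + z < 35) :
    12900 + 1142 * (x + y + z) ≤ x * bottomWeight (35 - x) + y * middleWeight (35 - (x + y)) +
      z * topWeight (35 - (x + y + z)) + 1142 * 17 := by
  have key : ∀ x < 35, ∀ y < 35 - x, ∀ z < 35 - x - y,
      12900 + 1142 * (x + y + z) ≤ x * bottomWeight (35 - x) + y * middleWeight (35 - (x + y)) +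
        z * topWeight (35 - (x + y + z)) + 1142 * 17 := by
    decide +kernel
  exact key x (by omega) y (by omega) z (by omega)

lemma deg_add_deg_sdiff {E F : Finset (Sym2 V)} (h : E ⊆ F) (v : V) :
    deg E v + deg (F \ E) v = deg F v := by
  unfold deg
  rw [← card_union_of_disjoint (disjoint_filter_filter disjoint_sdiff), ← filter_union,
    union_sdiff_of_subset h]

lemma deg_pos {E : Finset (Sym2 V)} {e : Sym2 V} {v : V} (he : e ∈ E) (hv : v ∈ e) :
    0 < deg E v :=
  card_pos.2 ⟨e, mem_filter.2 ⟨he, hv⟩⟩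

/-- Summing over vertices and incident edges is summing over edges and incident vertices. -/
lemma sum_deg_mul (S : Finset V) (E : Finset (Sym2 V)) (f : V → ℕ) :
    ∑ v ∈ S, deg E v * f v = ∑ e ∈ E, ∑ v ∈ S with v ∈ e, f v := by
  simp_rw [deg, ← smul_eq_mul, ← sum_const, sum_filter]
  exact sum_comm

section Bipartite

variable {P Q : Finset V} {E F : Finset (Sym2 V)}

lemma filter_mem_left (hPQ : Disjoint P Q) {u v : V} (hu : u ∈ P) (hv : v ∈ Q) :
    P.filter (· ∈ s(u, v)) = {u} := by
  ext w
  simp only [mem_filter, Sym2.mem_iff, mem_singleton]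
  refine ⟨?_, by rintro rfl; exact ⟨hu, Or.inl rfl⟩⟩
  rintro ⟨hw, rfl | rfl⟩
  · rfl
  · exact (disjoint_left.1 hPQ hw hv).elim

lemma filter_mem_right (hPQ : Disjoint P Q) {u v : V} (hu : u ∈ P) (hv : v ∈ Q) :
    Q.filter (· ∈ s(u, v)) = {v} := by
  rw [Sym2.eq_swap]
  exact filter_mem_left hPQ.symm hv hu

lemma sum_deg_left (hPQ : Disjoint P Q) (hE : ∀ e ∈ E, ∃ u v, e = s(u, v) ∧ u ∈ P ∧ v ∈ Q) :
    ∑ p ∈ P, deg E p = E.card := by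
  have h := sum_deg_mul P E fun _ => 1
  simp only [mul_one] at h
  rw [h, card_eq_sum_ones]
  refine sum_congr rfl fun e he => ?_
  obtain ⟨u, v, rfl, hu, hv⟩ := hE e he
  rw [filter_mem_left hPQ hu hv, sum_singleton]

/-- Edges of a new level charge their endpoint in `Q` at least as much as they pass on to their
endpoint in `P`. -/
lemma sum_charge_le {β : ℕ} {w : ℕ → ℕ} (hw : Antitone w) (hPQ : Disjoint P Q)
    (hE : ∀ e ∈ E, ∃ u v, e = s(u, v) ∧ u ∈ P ∧ v ∈ Q) (hdeg : ∀ e ∈ E, edeg F e ≤ β) :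
    ∑ p ∈ P, deg E p * w (β - deg F p) ≤ ∑ q ∈ Q, deg E q * w (deg F q) := by
  rw [sum_deg_mul P E fun p => w (β - deg F p), sum_deg_mul Q E fun q => w (deg F q)]
  refine sum_le_sum fun e he => ?_
  have hd := hdeg e he
  obtain ⟨u, v, rfl, hu, hv⟩ := hE e he
  rw [filter_mem_left hPQ hu hv, filter_mem_right hPQ hu hv, sum_singleton, sum_singleton]
  change deg F u + deg F v ≤ β at hd
  exact hw (by omega)

lemma deg_lt_of_mem {β : ℕ} {e : Sym2 V} {v : V} (he : e ∈ F) (hv : v ∈ e)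
    (hdeg : edeg F e ≤ β) : deg F v < β := by
  obtain ⟨u, rfl⟩ := hv
  have hu := deg_pos he (Sym2.mem_mk_right v u)
  change deg F v + deg F u ≤ β at hdeg
  omega

lemma deg_lt_of_subset {β : ℕ} (h : E ⊆ F) (hdeg : ∀ e ∈ F \ E, edeg F e ≤ β) {v : V}
    (hv : deg E v < β) : deg F v < β := by
  rcases Nat.eq_zero_or_pos (deg (F \ E) v) with h0 | h0
  · rwa [← deg_add_deg_sdiff h, h0]
  · obtain ⟨e, he⟩ := card_pos.1 h0
    rw [mem_filter] at he
    exact deg_lt_of_mem (sdiff_subset he.1) he.2 (hdeg e he.1)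

end Bipartite

/-- Every bipartite (35,3)-HEDCS `H` with vertex parts `P` and `Q`
having at least 34·|P|/2 edges satisfies |Q| ≥ 0.645·|P|. -/
theorem bipartite_hedcs_k3_beta35 {V : Type*} [DecidableEq V]
    (P Q : Finset V) (Hs : Finset (Sym2 V))
    (hH : IsBipartiteHEDCS P Q Hs 35 3)
    (hcard : (34 : ℝ) * P.card / 2 ≤ (Hs.card : ℝ)) :
    (0.645 : ℝ) * P.card ≤ (Q.card : ℝ) := by
  obtain ⟨hPQ, hbip, H, hH0, hH3, hsub, hdeg⟩ := hH
  have h01 : H 0 ⊆ H 1 := hsub 0 (by norm_num)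
  have h12 : H 1 ⊆ H 2 := hsub 1 (by norm_num)
  have h23 : H 2 ⊆ H 3 := hsub 2 (by norm_num)
  have hd1 : ∀ e ∈ H 1 \ H 0, edeg (H 1) e ≤ 35 := hdeg 1 le_rfl (by norm_num)
  have hd2 : ∀ e ∈ H 2 \ H 1, edeg (H 2) e ≤ 35 := hdeg 2 (by norm_num) (by norm_num)
  have hd3 : ∀ e ∈ H 3 \ H 2, edeg (H 3) e ≤ 35 := hdeg 3 (by norm_num) le_rfl
  rw [← hH3] at hbip hcard
  have hb2 : ∀ e ∈ H 2, _ := fun e he => hbip e (h23 he)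
  have hb1 : ∀ e ∈ H 1, _ := fun e he => hb2 e (h12 he)
  have hdeg0 (v : V) : deg (H 0) v = 0 := by simp [hH0, deg]
  have hdeg1 (v : V) : deg (H 1) v = deg (H 1 \ H 0) v := by
    rw [← deg_add_deg_sdiff h01, hdeg0, zero_add]
  have hdeg2 (v : V) : deg (H 2) v = deg (H 1 \ H 0) v + deg (H 2 \ H 1) v := by
    rw [← deg_add_deg_sdiff h12, hdeg1]
  have hdeg3 (v : V) :
      deg (H 3) v = deg (H 1 \ H 0) v + deg (H 2 \ H 1) v + deg (H 3 \ H 2) v := by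
    rw [← deg_add_deg_sdiff h23, hdeg2]
  have hlt (v : V) : deg (H 1 \ H 0) v + deg (H 2 \ H 1) v + deg (H 3 \ H 2) v < 35 := by
    rw [← hdeg3]
    exact deg_lt_of_subset h23 hd3 <| deg_lt_of_subset h12 hd2 <| deg_lt_of_subset h01 hd1 <| by
      rw [hdeg0]; norm_num
  have c1 := sum_charge_le bottomWeight_antitone hPQ (fun e he => hb1 e (sdiff_subset he)) hd1
  have c2 := sum_charge_le middleWeight_antitone hPQ (fun e he => hb2 e (sdiff_subset he)) hd2
  have c3 := sum_charge_le topWeight_antitone hPQ (fun e he => hbip e (sdiff_subset he)) hd3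
  have cP := sum_le_sum fun p (_ : p ∈ P) => le_charge (hlt p)
  have cQ := sum_le_sum fun q (_ : q ∈ Q) => charge_le (hlt q)
  have hsum := sum_deg_left hPQ hbip
  simp only [hdeg1, hdeg2, hdeg3] at c1 c2 c3 hsum
  simp only [sum_add_distrib, ← mul_sum, sum_const, smul_eq_mul] at cP cQ hsum
  have hE : 34 * P.card ≤ 2 * (H 3).card := by
    have h : (34 : ℝ) * P.card ≤ 2 * (H 3).card := by linarith
    exact_mod_cast h
  have hfinal : 12900 * P.card ≤ 20000 * Q.card := by omega
  have h : (12900 : ℝ) * P.card ≤ 20000 * Q.card := by exact_mod_cast hfinal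
  linarith
end
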